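/- Let p be a prime, K a finite extension of ℚ_p, and Γ a discrete subgroup of PGL(2,K) such that every nontrivial element of Γ has exactly two fixed points in P¹(K). Let Γ₁ and Γ₂ be subgroups of Γ that are in regular position. Then F_{Γ₁ ∩ Γ₂} = F_{Γ₁} ∩ F_{Γ₂}. -/

import Mathlib

open Matrix

/-- The projective general linear group `PGL(2,K)`: the quotient of `GL(2,K)` by its
center, the subgroup of nonzero scalar matrices.  When `K` is a topological (e.g. normed)
field, it carries the quotient topology coming from the topology on `GL(2,K)` (itself
topologized as the units of the ring of 2×2 matrices over `K`). -/
abbrev PGL2 (K : Type*) [Field K] : Type _ :=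
  GL (Fin 2) K ⧸ Subgroup.center (GL (Fin 2) K)

/-- The projective line `P¹(K)`, the projectivization of the `K`-vector space `K²`. -/
abbrev ProjLine (K : Type*) [Field K] : Type _ := Projectivization K (Fin 2 → K)

/-- The (linear) action of a matrix `A ∈ GL(2,K)` on the projective line `P¹(K)`. -/
noncomputable def GL2.onProj {K : Type*} [Field K] (A : GL (Fin 2) K) :
    ProjLine K → ProjLine K :=
  Projectivization.map
    (LinearMap.GeneralLinearGroup.toLinearEquiv (Matrix.GeneralLinearGroup.toLin A)).toLinearMap
    (LinearMap.GeneralLinearGroup.toLinearEquiv (Matrix.GeneralLinearGroup.toLin A)).injective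

/-- `PGL2.MapsTo g z w` says that the element `g ∈ PGL(2,K)` sends the point `z` of the
projective line to the point `w` (via any matrix representative of `g`; the center acts
trivially, so this does not depend on the representative). -/
def PGL2.MapsTo {K : Type*} [Field K] (g : PGL2 K) (z w : ProjLine K) : Prop :=
  ∀ A : GL (Fin 2) K, (QuotientGroup.mk A : PGL2 K) = g → GL2.onProj A z = w

/-- `z` is a fixed point of `g ∈ PGL(2,K)` acting on the projective line. -/
def PGL2.Fixes {K : Type*} [Field K] (g : PGL2 K) (z : ProjLine K) : Prop :=
  PGL2.MapsTo g z z

/-- The set of fixed points of `g ∈ PGL(2,K)` on the projective line. -/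
def PGL2.fixedPts {K : Type*} [Field K] (g : PGL2 K) : Set (ProjLine K) :=
  {z | PGL2.Fixes g z}

/-- The image in `PGL(2,K)` of the subgroup of invertible diagonal matrices. -/
def diagSubgroup (K : Type*) [Field K] : Subgroup (PGL2 K) :=
  Subgroup.map (QuotientGroup.mk' (Subgroup.center (GL (Fin 2) K)))
    (MonoidHom.range (Units.map (Matrix.diagonalRingHom (Fin 2) K).toMonoidHom))

/-- A `K`-split torus in `PGL(2,K)`: a subgroup conjugate in `PGL(2,K)` to the image of
the invertible diagonal matrices. -/
def IsSplitTorus {K : Type*} [Field K] (T : Subgroup (PGL2 K)) : Prop :=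
  ∃ g : PGL2 K, T = Subgroup.map (MulAut.conj g).toMonoidHom (diagSubgroup K)

/-- Two subgroups `G₁, G₂` of `PGL(2,K)` are in regular position if for every `K`-split
torus `T`, `G₁ ∩ T ≠ {1}` and `G₂ ∩ T ≠ {1}` together imply `G₁ ∩ G₂ ∩ T ≠ {1}`. -/
def InRegularPosition {K : Type*} [Field K] (G₁ G₂ : Subgroup (PGL2 K)) : Prop :=
  ∀ T : Subgroup (PGL2 K), IsSplitTorus T →
    G₁ ⊓ T ≠ ⊥ → G₂ ⊓ T ≠ ⊥ → G₁ ⊓ G₂ ⊓ T ≠ ⊥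

/-- `F_G`: the set of points of `P¹(K)` fixed by at least one nontrivial element of the
subgroup `G` of `PGL(2,K)`. -/
def PGL2.fixedPtSet {K : Type*} [Field K] (G : Subgroup (PGL2 K)) : Set (ProjLine K) :=
  {z | ∃ g ∈ G, g ≠ 1 ∧ PGL2.Fixes g z}

section aux
variable {K : Type*} [Field K]

lemma onProj_fix_iff (A : GL (Fin 2) K) (v : Fin 2 → K) (hv : v ≠ 0) :
    GL2.onProj A (Projectivization.mk K v hv) = Projectivization.mk K v hv ↔
      ∃ c : K, A.1 *ᵥ v = c • v := by
  unfold GL2.onProj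
  rw [Projectivization.map_mk, Projectivization.mk_eq_mk_iff']
  constructor
  · rintro ⟨a, ha⟩
    exact ⟨a, ha.symm⟩
  · rintro ⟨a, ha⟩
    exact ⟨a, ha.symm⟩

lemma center_scalar (C : GL (Fin 2) K) (hC : C ∈ Subgroup.center (GL (Fin 2) K)) :
    ∃ c : K, ∀ v : Fin 2 → K, C.1 *ᵥ v = c • v := by
  rw [Matrix.GeneralLinearGroup.center_eq_range_scalar] at hC
  obtain ⟨c, rfl⟩ := hC
  refine ⟨c, fun v => ?_⟩
  simp [Matrix.GeneralLinearGroup.scalar]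

lemma scalar_center (C : GL (Fin 2) K) (c : K) (h : C.1 = Matrix.scalar (Fin 2) c) :
    (QuotientGroup.mk C : PGL2 K) = 1 := by
  rw [QuotientGroup.eq_one_iff, Subgroup.mem_center_iff]
  intro g
  ext1
  simp only [Units.val_mul, h]
  exact ((Matrix.scalar_commute c (fun r => Commute.all _ _) g.1).eq).symm

lemma fixes_mk_iff (A : GL (Fin 2) K) (v : Fin 2 → K) (hv : v ≠ 0) :
    PGL2.Fixes (QuotientGroup.mk A : PGL2 K) (Projectivization.mk K v hv) ↔
      ∃ c : K, A.1 *ᵥ v = c • v := by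
  constructor
  · intro h
    exact (onProj_fix_iff A v hv).1 (h A rfl)
  · rintro ⟨a, ha⟩ B hB
    rw [onProj_fix_iff]
    have h2 := QuotientGroup.eq.1 hB.symm
    obtain ⟨c, hc⟩ := center_scalar _ h2
    refine ⟨c * a, ?_⟩
    have h3 : B = A * (A⁻¹ * B) := by group
    rw [h3, Units.val_mul, ← Matrix.mulVec_mulVec, hc, Matrix.mulVec_smul, ha, smul_smul]

lemma det_ne (v u : Fin 2 → K) (hv : v ≠ 0) (hu : u ≠ 0)
    (h : Projectivization.mk K v hv ≠ Projectivization.mk K u hu) :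
    !![v 0, u 0; v 1, u 1].det ≠ 0 := by
  intro h0
  rw [Matrix.det_fin_two_of] at h0
  apply h
  symm
  rw [Projectivization.mk_eq_mk_iff']
  by_cases h1 : v 0 = 0
  · have h2 : v 1 ≠ 0 := by
      intro h2
      apply hv
      ext i
      fin_cases i <;> simp [h1, h2]
    have h3 : u 0 = 0 := by
      simpa [h1, h2] using h0
    refine ⟨u 1 / v 1, ?_⟩
    ext i
    fin_cases i <;> simp [h1, h2, h3]
  · refine ⟨u 0 / v 0, ?_⟩
    ext i
    fin_cases i
    · simp [h1]
    · simp
      field_simp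
      linear_combination -h0

/-- matrix with columns `v`, `u` -/
lemma mul_cols (A : Matrix (Fin 2) (Fin 2) K) (v u : Fin 2 → K) (a b : K)
    (h1 : A *ᵥ v = a • v) (h2 : A *ᵥ u = b • u) :
    A * !![v 0, u 0; v 1, u 1] = !![v 0, u 0; v 1, u 1] * Matrix.diagonal ![a, b] := by
  have e1 := congrFun h1 0
  have e2 := congrFun h1 1
  have e3 := congrFun h2 0
  have e4 := congrFun h2 1
  simp [Matrix.mulVec, dotProduct, Fin.sum_univ_two] at e1 e2 e3 e4
  ext i j
  fin_cases i <;> fin_cases j <;> simp [Matrix.mul_apply, Fin.sum_univ_two]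
  · linear_combination e1
  · linear_combination e3
  · linear_combination e2
  · linear_combination e4

lemma eq_scalar (A P : Matrix (Fin 2) (Fin 2) K) (hP : P.det ≠ 0) (a : K)
    (h : A * P = P * Matrix.diagonal ![a, a]) : A = Matrix.scalar (Fin 2) a := by
  have h1 : Matrix.diagonal ![a, a] = Matrix.scalar (Fin 2) a := by
    ext i j
    fin_cases i <;> fin_cases j <;> simp
  have hu : IsUnit P := (Matrix.isUnit_iff_isUnit_det P).2 hP.isUnit
  apply hu.mul_right_cancel
  rw [h, h1]
  exact ((Matrix.scalar_commute a (fun r => Commute.all _ _) P).eq).symm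

lemma torus_mem (A P : GL (Fin 2) K) (a b : K)
    (h : A.1 * P.1 = P.1 * Matrix.diagonal ![a, b]) :
    (QuotientGroup.mk A : PGL2 K) ∈
      Subgroup.map (MulAut.conj (QuotientGroup.mk P : PGL2 K)).toMonoidHom (diagSubgroup K) := by
  have hdet : a * b ≠ 0 := by
    have := congrArg Matrix.det h
    rw [Matrix.det_mul, Matrix.det_mul, Matrix.det_diagonal, Fin.prod_univ_two] at this
    simp only [Matrix.cons_val_zero, Matrix.cons_val_one] at this
    intro h0
    rw [h0, mul_zero] at this
    have hA := (Matrix.isUnits_det_units A).ne_zero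
    have hP := (Matrix.isUnits_det_units P).ne_zero
    exact mul_ne_zero hA hP this
  have ha : a ≠ 0 := left_ne_zero_of_mul hdet
  have hb : b ≠ 0 := right_ne_zero_of_mul hdet
  let d : (Fin 2 → K)ˣ := ⟨![a, b], ![a⁻¹, b⁻¹], by
    ext i
    fin_cases i <;> simp [ha, hb], by
    ext i
    fin_cases i <;> simp [ha, hb]⟩
  refine ⟨QuotientGroup.mk (Units.map (Matrix.diagonalRingHom (Fin 2) K).toMonoidHom d),
    ⟨_, ⟨d, rfl⟩, rfl⟩, ?_⟩
  have : A = P * (Units.map (Matrix.diagonalRingHom (Fin 2) K).toMonoidHom d) * P⁻¹ := by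
    rw [eq_mul_inv_iff_mul_eq]
    ext1
    exact h
  conv_rhs => rw [this]
  rfl

lemma torus_fixes (g : PGL2 K) (P : GL (Fin 2) K) (v u : Fin 2 → K) (hv : v ≠ 0)
    (hP : P.1 = !![v 0, u 0; v 1, u 1])
    (h : g ∈ Subgroup.map (MulAut.conj (QuotientGroup.mk P : PGL2 K)).toMonoidHom
      (diagSubgroup K)) : PGL2.Fixes g (Projectivization.mk K v hv) := by
  obtain ⟨_, ⟨_, ⟨d, rfl⟩, rfl⟩, rfl⟩ := h
  change PGL2.Fixes (QuotientGroup.mk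
    (P * (Units.map (Matrix.diagonalRingHom (Fin 2) K).toMonoidHom d) * P⁻¹) : PGL2 K) _
  rw [fixes_mk_iff]
  have hPv : P.1 *ᵥ ![1, 0] = v := by
    rw [hP]
    ext i
    fin_cases i <;> simp [Matrix.mulVec, dotProduct]
  have hPv' : P⁻¹.1 *ᵥ v = ![1, 0] := by
    rw [← hPv, Matrix.mulVec_mulVec, ← Units.val_mul]
    simp
  refine ⟨d.1 0, ?_⟩
  rw [Units.val_mul, Units.val_mul, ← Matrix.mulVec_mulVec, hPv', ← Matrix.mulVec_mulVec]
  have : (Units.map (Matrix.diagonalRingHom (Fin 2) K).toMonoidHom d).1 *ᵥ ![1, 0]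
      = d.1 0 • ![1, 0] := by
    change Matrix.diagonal d.1 *ᵥ _ = _
    ext i
    fin_cases i <;> simp [Matrix.mulVec_diagonal]
  rw [this, Matrix.mulVec_smul, hPv]

lemma exists_other (g : PGL2 K) (z : ProjLine K) (h : (PGL2.fixedPts g).encard = 2) :
    ∃ w, w ≠ z ∧ PGL2.Fixes g w := by
  obtain ⟨x, y, hxy, he⟩ := Set.encard_eq_two.1 h
  have hx : x ∈ PGL2.fixedPts g := by rw [he]; simp
  have hy : y ∈ PGL2.fixedPts g := by rw [he]; simp
  by_cases hz : x = z
  · exact ⟨y, fun h => hxy (hz.trans h.symm), hy⟩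
  · exact ⟨x, hz, hx⟩

lemma comm_of_fix (Γ : Subgroup (PGL2 K))
    (hfix : ∀ γ ∈ Γ, γ ≠ 1 → (PGL2.fixedPts γ).encard = 2)
    (A B : GL (Fin 2) K) (hA : (QuotientGroup.mk A : PGL2 K) ∈ Γ)
    (hB : (QuotientGroup.mk B : PGL2 K) ∈ Γ) (v : Fin 2 → K) (hv : v ≠ 0) (a b : K)
    (hAv : A.1 *ᵥ v = a • v) (hBv : B.1 *ᵥ v = b • v) : A * B = B * A := by
  set D : GL (Fin 2) K := A * B * A⁻¹ * B⁻¹ with hD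
  have inv : ∀ (C : GL (Fin 2) K) (c : K), C.1 *ᵥ v = c • v →
      c ≠ 0 ∧ C⁻¹.1 *ᵥ v = c⁻¹ • v := by
    intro C c hC
    have h1 : v = c • (C⁻¹.1 *ᵥ v) := by
      rw [← Matrix.mulVec_smul, ← hC, Matrix.mulVec_mulVec, ← Units.val_mul]
      simp
    have hc : c ≠ 0 := by
      rintro rfl
      rw [zero_smul] at h1
      exact hv h1
    refine ⟨hc, ?_⟩
    conv_rhs => rw [h1]
    rw [smul_smul, inv_mul_cancel₀ hc, one_smul]
  obtain ⟨ha, hAi⟩ := inv A a hAv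
  obtain ⟨hb, hBi⟩ := inv B b hBv
  have hDv : D.1 *ᵥ v = (1 : K) • v := by
    simp only [hD, Units.val_mul, ← Matrix.mulVec_mulVec]
    simp only [hBi, hAi, hAv, hBv, Matrix.mulVec_smul, smul_smul]
    congr 1
    field_simp
  have hDΓ : (QuotientGroup.mk D : PGL2 K) ∈ Γ :=
    Γ.mul_mem (Γ.mul_mem (Γ.mul_mem hA hB) (Γ.inv_mem hA)) (Γ.inv_mem hB)
  have hD1 : (QuotientGroup.mk D : PGL2 K) = 1 := by
    by_contra hne
    obtain ⟨w, hw, hwf⟩ := exists_other _ (Projectivization.mk K v hv) (hfix _ hDΓ hne)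
    induction w using Projectivization.ind with
    | h u hu =>
      obtain ⟨m, hm⟩ := (fixes_mk_iff D u hu).1 hwf
      have hP := det_ne v u hv hu hw.symm
      have h1 := mul_cols D.1 v u 1 m hDv hm
      have hdet : D.1.det = 1 := by
        have : Matrix.GeneralLinearGroup.det D = 1 := by
          rw [hD]
          simp only [map_mul, map_inv]
          rw [mul_comm (Matrix.GeneralLinearGroup.det A)]
          group
        exact congrArg Units.val this
      have h2 := congrArg Matrix.det h1
      rw [Matrix.det_mul, Matrix.det_mul, hdet, mul_comm, Matrix.det_diagonal,
        Fin.prod_univ_two] at h2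
      have hm1 : m = 1 := by
        have := mul_left_cancel₀ hP h2
        simpa using this.symm
      rw [hm1] at h1
      exact hne (scalar_center D 1 (eq_scalar _ _ hP 1 h1))
  obtain ⟨c, hc⟩ := center_scalar D ((QuotientGroup.eq_one_iff D).1 hD1)
  have hc1 : c = 1 := by
    have := (hc v).symm.trans hDv
    exact smul_left_injective K hv this
  have hDone : D = 1 := by
    ext1
    apply Matrix.ext_of_mulVec_single
    intro i
    rw [hc, hc1, one_smul, Units.val_one, Matrix.one_mulVec]
  have : A * B = D * (B * A) := by rw [hD]; group
  rw [this, hDone, one_mul]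

end aux

/-- Let `p` be a prime, `K` a finite extension of `ℚ_p` (a normed field which is a finite
dimensional normed `ℚ_p`-algebra), and `Γ` a discrete subgroup of `PGL(2,K)` such that
every nontrivial element of `Γ` has exactly two fixed points in `P¹(K)`.  If `Γ₁` and
`Γ₂` are subgroups of `Γ` in regular position, then
`F_{Γ₁ ∩ Γ₂} = F_{Γ₁} ∩ F_{Γ₂}`. -/
theorem fixedPtSet_inf_of_regular_position (p : ℕ) [Fact p.Prime]
    (K : Type*) [NormedField K] [NormedAlgebra ℚ_[p] K] [FiniteDimensional ℚ_[p] K]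
    (Γ : Subgroup (PGL2 K)) [DiscreteTopology Γ]
    (hfix : ∀ γ ∈ Γ, γ ≠ 1 → (PGL2.fixedPts γ).encard = 2)
    (Γ₁ Γ₂ : Subgroup (PGL2 K)) (h₁ : Γ₁ ≤ Γ) (h₂ : Γ₂ ≤ Γ)
    (hreg : InRegularPosition Γ₁ Γ₂) :
    PGL2.fixedPtSet (Γ₁ ⊓ Γ₂) = PGL2.fixedPtSet Γ₁ ∩ PGL2.fixedPtSet Γ₂ := by
  ext z
  constructor
  · rintro ⟨g, hg, hg1, hz⟩
    exact ⟨⟨g, hg.1, hg1, hz⟩, ⟨g, hg.2, hg1, hz⟩⟩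
  rintro ⟨⟨g₁, hg₁, hne₁, hz₁⟩, ⟨g₂, hg₂, hne₂, hz₂⟩⟩
  obtain ⟨w, hw, hwf⟩ := exists_other g₁ z (hfix g₁ (h₁ hg₁) hne₁)
  obtain ⟨A, rfl⟩ := QuotientGroup.mk_surjective g₁
  obtain ⟨B, rfl⟩ := QuotientGroup.mk_surjective g₂
  induction z using Projectivization.ind with
  | h v hv =>
  induction w using Projectivization.ind with
  | h u hu =>
  obtain ⟨a, hAv⟩ := (fixes_mk_iff A v hv).1 hz₁
  obtain ⟨b, hAu⟩ := (fixes_mk_iff A u hu).1 hwf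
  obtain ⟨c, hBv⟩ := (fixes_mk_iff B v hv).1 hz₂
  have hcomm := comm_of_fix Γ hfix A B (h₁ hg₁) (h₂ hg₂) v hv a c hAv hBv
  have hdet := det_ne v u hv hu hw.symm
  have hab : a ≠ b := by
    rintro rfl
    exact hne₁ (scalar_center A a (eq_scalar _ _ hdet a (mul_cols A.1 v u a a hAv hAu)))
  obtain ⟨d, hBu⟩ : ∃ d : K, B.1 *ᵥ u = d • u := by
    by_contra hno
    set u' := B.1 *ᵥ u with hu'
    have hu'0 : u' ≠ 0 := by
      intro h0
      exact hno ⟨0, by rw [h0, zero_smul]⟩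
    have hAu' : A.1 *ᵥ u' = b • u' := by
      rw [hu', Matrix.mulVec_mulVec, ← Units.val_mul, hcomm, Units.val_mul,
        ← Matrix.mulVec_mulVec, hAu, Matrix.mulVec_smul]
    have hne : Projectivization.mk K u hu ≠ Projectivization.mk K u' hu'0 := by
      intro h
      obtain ⟨e, he⟩ := (Projectivization.mk_eq_mk_iff' K _ _ _ _).1 h.symm
      exact hno ⟨e, he.symm⟩
    have hd := det_ne u u' hu hu'0 hne
    exact hne₁ (scalar_center A b (eq_scalar _ _ hd b (mul_cols A.1 u u' b b hAu hAu')))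
  let P : GL (Fin 2) K := Matrix.GeneralLinearGroup.mkOfDetNeZero _ hdet
  have hP : P.1 = !![v 0, u 0; v 1, u 1] := rfl
  have hAT := torus_mem A P a b (mul_cols A.1 v u a b hAv hAu)
  have hBT := torus_mem B P c d (mul_cols B.1 v u c d hBv hBu)
  have key := hreg _ ⟨QuotientGroup.mk P, rfl⟩
    (fun h => hne₁ ((Subgroup.eq_bot_iff_forall _).1 h _ ⟨hg₁, hAT⟩))
    (fun h => hne₂ ((Subgroup.eq_bot_iff_forall _).1 h _ ⟨hg₂, hBT⟩))
  obtain ⟨⟨g, hg⟩, hg1⟩ := Subgroup.ne_bot_iff_exists_ne_one.1 key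
  exact ⟨g, hg.1, fun h => hg1 (Subtype.ext h), torus_fixes g P v u hv hP hg.2⟩
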